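/- arXiv:2408.03833 — 6 statements merged into one kernel-verified Lean document; each statement's English description precedes it below -/
import Mathlib

section
/- The set function f(S) = rank(∑_{j∈S} M_j), where each M_j is an n×n real positive semidefinite matrix, is submodular: for all A ⊆ B ⊆ V and every s ∈ V with s ∉ B, f(A ∪ {s}) − f(A) ≥ f(B ∪ {s}) − f(B). -/
open Finset Matrix

/-- The kernel of a sum of two positive semidefinite matrices is the intersection of the
kernels. -/
theorem Matrix.PosSemidef.ker_mulVecLin_add {ι : Type*} [Fintype ι] {P Q : Matrix ι ι ℝ}
    (hP : P.PosSemidef) (hQ : Q.PosSemidef) :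
    LinearMap.ker (P + Q).mulVecLin = LinearMap.ker P.mulVecLin ⊓ LinearMap.ker Q.mulVecLin := by
  ext x
  simp only [Submodule.mem_inf, LinearMap.mem_ker, mulVecLin_apply]
  constructor
  · intro h
    have hp := hP.dotProduct_mulVec_nonneg x
    have hq := hQ.dotProduct_mulVec_nonneg x
    have hsum : star x ⬝ᵥ (P *ᵥ x) + star x ⬝ᵥ (Q *ᵥ x) = 0 := by
      rw [← dotProduct_add, ← add_mulVec, h, dotProduct_zero]
    rw [← hP.dotProduct_mulVec_zero_iff, ← hQ.dotProduct_mulVec_zero_iff]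
    constructor <;> linarith
  · rintro ⟨hp, hq⟩
    rw [add_mulVec, hp, hq, add_zero]

theorem Matrix.rank_add_finrank_ker_mulVecLin {ι : Type*} [Fintype ι] (P : Matrix ι ι ℝ) :
    P.rank + Module.finrank ℝ (LinearMap.ker P.mulVecLin) = Fintype.card ι := by
  rw [Matrix.rank, LinearMap.finrank_range_add_finrank_ker, Module.finrank_fintype_fun_eq_card]

/-- Submodularity of the rank on positive semidefinite matrices. -/
theorem Matrix.PosSemidef.rank_add_add_le {ι : Type*} [Fintype ι] {P Q R : Matrix ι ι ℝ}
    (hP : P.PosSemidef) (hQ : Q.PosSemidef) (hR : R.PosSemidef) :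
    (P + R + Q).rank + P.rank ≤ (P + Q).rank + (P + R).rank := by
  have hPRQ := rank_add_finrank_ker_mulVecLin (P + R + Q)
  have hPQ := rank_add_finrank_ker_mulVecLin (P + Q)
  have hPR := rank_add_finrank_ker_mulVecLin (P + R)
  have hP' := rank_add_finrank_ker_mulVecLin P
  rw [(hP.add hR).ker_mulVecLin_add hQ] at hPRQ
  rw [hP.ker_mulVecLin_add hQ] at hPQ
  have hle : LinearMap.ker (P + R).mulVecLin ≤ LinearMap.ker P.mulVecLin :=
    (hP.ker_mulVecLin_add hR).trans_le inf_le_left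
  have hmono := Submodule.finrank_mono (sup_le_sup_right hle (LinearMap.ker Q.mulVecLin))
  have hdim := Submodule.finrank_sup_add_finrank_inf_eq
    (LinearMap.ker P.mulVecLin) (LinearMap.ker Q.mulVecLin)
  have hdim' := Submodule.finrank_sup_add_finrank_inf_eq
    (LinearMap.ker (P + R).mulVecLin) (LinearMap.ker Q.mulVecLin)
  omega

/-- The set function `f(S) = rank(∑_{j∈S} M_j)`, with each `M_j` an `n×n` real
positive semidefinite matrix, is submodular: for all `A ⊆ B ⊆ V` and `s ∉ B`,
`f(A ∪ {s}) − f(A) ≥ f(B ∪ {s}) − f(B)`. -/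
theorem rank_sum_psd_submodular {V : Type*} [DecidableEq V] (n : ℕ)
    (M : V → Matrix (Fin n) (Fin n) ℝ) (hM : ∀ j, (M j).PosSemidef)
    (A B : Finset V) (hAB : A ⊆ B) (s : V) (hs : s ∉ B) :
    ((∑ j ∈ B ∪ {s}, M j).rank : ℝ) - (∑ j ∈ B, M j).rank ≤
      ((∑ j ∈ A ∪ {s}, M j).rank : ℝ) - (∑ j ∈ A, M j).rank := by
  have hunion : ∀ S ⊆ B, ∑ j ∈ S ∪ {s}, M j = ∑ j ∈ S, M j + M s := fun S hS ↦ by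
    rw [sum_union (disjoint_singleton_right.2 fun h ↦ hs (hS h)), sum_singleton]
  have hsplit : ∑ j ∈ B, M j = ∑ j ∈ A, M j + ∑ j ∈ B \ A, M j := by
    rw [add_comm, sum_sdiff hAB]
  have hrank := (posSemidef_sum A fun j _ ↦ hM j).rank_add_add_le (hM s)
    (posSemidef_sum (B \ A) fun j _ ↦ hM j)
  rw [← hsplit] at hrank
  rw [hunion B Subset.rfl, hunion A hAB, sub_le_sub_iff]
  exact_mod_cast hrank
end

section
/- Let X, Y, S be n×n real symmetric matrices with X positive definite, X ⪯ Y (i.e., Y − X positive semidefinite), and S positive semidefinite. Then log det(Y + S) − log det(Y) ≤ log det(X + S) − log det(X); that is, the increment of log det upon adding a fixed positive semidefinite matrix is monotone decreasing in the Loewner order. -/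
open Matrix

namespace Matrix

variable {m : Type*} [Fintype m] [DecidableEq m]

theorem PosSemidef.one_le_det_one_add {M : Matrix m m ℝ} (hM : M.PosSemidef) :
    1 ≤ (1 + M).det := by
  have hneg : (-M).IsHermitian := hM.isHermitian.neg
  have hdet : (1 + M).det = ∏ i, (1 - hneg.eigenvalues i) := by
    have h := congrArg (Polynomial.eval 1) hneg.charpoly_eq
    simpa [eval_charpoly, Polynomial.eval_prod] using h
  rw [hdet]
  refine Finset.one_le_prod fun i _ => ?_
  have hle : hneg.eigenvalues i ≤ 0 := by
    rw [hneg.eigenvalues_eq]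
    simpa [neg_mulVec] using hM.re_dotProduct_nonneg (hneg.eigenvectorBasis i)
  linarith

open scoped MatrixOrder Matrix.Norms.L2Operator in
theorem PosSemidef.exists_eq_conjTranspose_mul_self {M : Matrix m m ℝ} (hM : M.PosSemidef) :
    ∃ B : Matrix m m ℝ, M = Bᴴ * B :=
  CStarAlgebra.nonneg_iff_eq_star_mul_self.mp hM.nonneg

theorem PosDef.det_le_det {P Q : Matrix m m ℝ} (hP : P.PosDef) (hPQ : (Q - P).PosSemidef) :
    P.det ≤ Q.det := by
  obtain ⟨B, hB⟩ := hPQ.exists_eq_conjTranspose_mul_self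
  rw [← add_sub_cancel P Q, hB, det_add_mul _ _ hP.det_pos.ne'.isUnit]
  exact le_mul_of_one_le_right hP.det_pos.le
    (hP.posSemidef.inv.mul_mul_conjTranspose_same B).one_le_det_one_add

theorem PosDef.inv_sub_inv_posSemidef {X Y : Matrix m m ℝ} (hX : X.PosDef) (hY : Y.PosDef)
    (hXY : (Y - X).PosSemidef) : (X⁻¹ - Y⁻¹).PosSemidef := by
  have := hY.isUnit.invertible
  have := hX.inv.isUnit.invertible
  have hX' : X⁻¹⁻¹ = X := nonsing_inv_nonsing_inv X hX.det_pos.ne'.isUnit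
  have h := (PosDef.fromBlocks₂₂ Y 1 hX.inv).mpr (by simpa [hX'] using hXY)
  simpa using (PosDef.fromBlocks₁₁ 1 X⁻¹ hY).mp h

end Matrix

/-- For real symmetric matrices `X, Y, S` with `X` positive definite, `X ⪯ Y`
(i.e. `Y − X` positive semidefinite) and `S` positive semidefinite, the increment
of `log det` upon adding `S` is monotone decreasing in the Loewner order:
`log det(Y + S) − log det Y ≤ log det(X + S) − log det X`. -/
theorem logDet_increment_antitone (n : ℕ) (X Y S : Matrix (Fin n) (Fin n) ℝ)
    (hX : X.PosDef) (hY : Y.IsHermitian) (hXY : (Y - X).PosSemidef)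
    (hS : S.PosSemidef) :
    Real.log (Y + S).det - Real.log Y.det ≤
      Real.log (X + S).det - Real.log X.det := by
  have hYpos : Y.PosDef := by simpa using hX.add_posSemidef hXY
  obtain ⟨B, rfl⟩ := hS.exists_eq_conjTranspose_mul_self
  have one_add_posDef {A : Matrix (Fin n) (Fin n) ℝ} (hA : A.PosDef) :
      (1 + B * A⁻¹ * Bᴴ).PosDef :=
    PosDef.one.add_posSemidef (hA.posSemidef.inv.mul_mul_conjTranspose_same B)
  have log_increment {A : Matrix (Fin n) (Fin n) ℝ} (hA : A.PosDef) :
      Real.log (A + Bᴴ * B).det - Real.log A.det = Real.log (1 + B * A⁻¹ * Bᴴ).det := by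
    rw [det_add_mul _ _ hA.det_pos.ne'.isUnit,
      Real.log_mul hA.det_pos.ne' (one_add_posDef hA).det_pos.ne', add_sub_cancel_left]
  rw [log_increment hYpos, log_increment hX]
  refine Real.log_le_log (one_add_posDef hYpos).det_pos ((one_add_posDef hYpos).det_le_det ?_)
  have h := (hX.inv_sub_inv_posSemidef hYpos hXY).mul_mul_conjTranspose_same B
  simpa [Matrix.mul_sub, Matrix.sub_mul] using h
end

section
/- If f is submodular, then the mixed second differences of its multilinear extension are nonpositive: for all distinct a, b ∈ V and every x ∈ [0,1]^V, F(x^{a→1,b→1}) − F(x^{a→1,b→0}) − F(x^{a→0,b→1}) + F(x^{a→0,b→0}) ≤ 0, where x^{a→α,b→β} denotes x with its a-th coordinate replaced by α and b-th coordinate replaced by β. Equivalently, the mixed second partial derivative ∂²F/∂x_a∂x_b is nonpositive on [0,1]^V. -/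
open Finset

/-- The multilinear extension of a set function `f : 2^V → ℝ`:
`F(x) = ∑_{S⊆V} f(S) ∏_{s∈S} x_s ∏_{s∉S} (1 − x_s)`. -/
noncomputable def multilinearExt {V : Type*} [Fintype V] [DecidableEq V]
    (f : Finset V → ℝ) (x : V → ℝ) : ℝ :=
  ∑ S : Finset V, f S * ((∏ s ∈ S, x s) * ∏ s ∈ Sᶜ, (1 - x s))

/-- Conditioning on whether the element `a` is chosen: the multilinear extension as a sum over the
sets avoiding `a`. -/
theorem multilinearExt_eq_sum_erase {V : Type*} [Fintype V] [DecidableEq V]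
    (f : Finset V → ℝ) (x : V → ℝ) (a : V) :
    multilinearExt f x = ∑ T ∈ (univ.erase a).powerset,
      ((∏ s ∈ T, x s) * ∏ s ∈ univ.erase a \ T, (1 - x s)) *
        ((1 - x a) * f T + x a * f (insert a T)) := by
  have huniv : (univ : Finset (Finset V)) = (insert a (univ.erase a)).powerset := by
    rw [insert_erase (mem_univ a), powerset_univ]
  rw [multilinearExt, huniv, sum_powerset_insert (notMem_erase a univ), ← sum_add_distrib]
  refine sum_congr rfl fun T hT => ?_
  have haT : a ∉ T := fun h => notMem_erase a univ (mem_powerset.1 hT h)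
  have hcompl : Tᶜ = insert a (univ.erase a \ T) := by
    ext s
    by_cases hs : s = a <;> simp_all
  have hcompl_insert : (insert a T)ᶜ = univ.erase a \ T := by
    ext s
    simp
  have ha : a ∉ univ.erase a \ T := by simp
  rw [hcompl_insert, hcompl, prod_insert haT, prod_insert ha]
  ring

theorem multilinearExt_update {V : Type*} [Fintype V] [DecidableEq V]
    (f : Finset V → ℝ) (x : V → ℝ) (a : V) (c : ℝ) :
    multilinearExt f (Function.update x a c) =
      multilinearExt (fun S => (1 - c) * f (S.erase a) + c * f (insert a S)) x := by
  rw [multilinearExt_eq_sum_erase _ _ a, multilinearExt_eq_sum_erase _ x a]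
  refine sum_congr rfl fun T hT => ?_
  have haT : a ∉ T := fun h => notMem_erase a univ (mem_powerset.1 hT h)
  have ha : a ∉ univ.erase a \ T := by simp
  have hprod : ∏ s ∈ T, Function.update x a c s = ∏ s ∈ T, x s :=
    prod_congr rfl fun s hs => Function.update_of_ne (ne_of_mem_of_not_mem hs haT) c x
  have hprod_compl : ∏ s ∈ univ.erase a \ T, (1 - Function.update x a c s) =
      ∏ s ∈ univ.erase a \ T, (1 - x s) :=
    prod_congr rfl fun s hs => by rw [Function.update_of_ne (ne_of_mem_of_not_mem hs ha) c x]
  rw [hprod, hprod_compl]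
  simp only [Function.update_self, erase_insert haT, erase_eq_of_notMem haT, insert_idem]
  ring

/-- If `f` is submodular, the mixed second differences of its multilinear
extension are nonpositive on the unit cube (equivalently, the mixed second
partial derivatives `∂²F/∂x_a∂x_b` are nonpositive). -/
theorem multilinearExt_mixed_second_diff_nonpos {V : Type*} [Fintype V] [DecidableEq V]
    (f : Finset V → ℝ)
    (hf : ∀ A B : Finset V, A ⊆ B → ∀ s ∉ B,
      f (B ∪ {s}) - f B ≤ f (A ∪ {s}) - f A)
    (a b : V) (hab : a ≠ b) (x : V → ℝ) (hx : ∀ s, x s ∈ Set.Icc (0 : ℝ) 1) :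
    multilinearExt f (Function.update (Function.update x a 1) b 1) -
        multilinearExt f (Function.update (Function.update x a 1) b 0) -
        multilinearExt f (Function.update (Function.update x a 0) b 1) +
        multilinearExt f (Function.update (Function.update x a 0) b 0) ≤ 0 := by
  simp only [multilinearExt_update, sub_self, sub_zero, zero_mul, one_mul, zero_add, add_zero]
  simp only [multilinearExt, ← sum_sub_distrib, ← sum_add_distrib, ← sub_mul, ← add_mul]
  refine sum_nonpos fun S _ => mul_nonpos_of_nonpos_of_nonneg ?_ ?_
  · have h := hf ((S.erase b).erase a) (insert b (S.erase a))
      (fun s hs => by simp_all) a (by simp [hab])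
    have h_union : insert b (S.erase a) ∪ {a} = insert b (insert a S) := by
      ext s
      by_cases hs : s = a <;> simp_all
    have h_erase_union : (S.erase b).erase a ∪ {a} = (insert a S).erase b := by
      ext s
      by_cases hs : s = a <;> simp_all
    rw [h_union, h_erase_union, erase_right_comm] at h
    linarith
  · exact mul_nonneg (prod_nonneg fun s _ => (hx s).1)
      (prod_nonneg fun s _ => sub_nonneg.2 (hx s).2)
end

section
/- If f is submodular, then for all distinct a, b ∈ V and every x ∈ [0,1]^V, the function t ↦ F(x + t(e_a − e_b)) is convex on the interval of t for which x + t(e_a − e_b) remains in [0,1]^V, where e_a and e_b are the standard basis vectors of ℝ^V. (This convexity along the directions e_a − e_b is the property exploited by the pipage rounding procedure.) -/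
open Finset

/-- Expansion of the multilinear extension in the two coordinates `a` and `b`. -/
theorem multilinearExt_eq_sum_powerset_erase_erase {V : Type*} [Fintype V] [DecidableEq V]
    (f : Finset V → ℝ) {a b : V} (hab : a ≠ b) (y : V → ℝ) :
    multilinearExt f y = ∑ T ∈ ((univ.erase a).erase b).powerset,
      ((∏ s ∈ T, y s) * ∏ s ∈ ((univ.erase a).erase b) \ T, (1 - y s)) *
        ((1 - y a) * (1 - y b) * f T + y a * (1 - y b) * f (insert a T)
          + (1 - y a) * y b * f (insert b T) + y a * y b * f (insert a (insert b T))) := by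
  set R : Finset V := (univ.erase a).erase b with hR
  have haR : a ∉ R := by simp [hR]
  have hbR : b ∉ R := by simp [hR]
  have haR' : a ∉ insert b R := by simp [hab, haR]
  have huniv : (univ : Finset (Finset V)) = (insert a (insert b R)).powerset := by
    rw [← Finset.powerset_univ]
    congr 1
    ext s
    simp only [hR, mem_univ, mem_insert, mem_erase]
    tauto
  unfold multilinearExt
  rw [huniv, sum_powerset_insert haR', sum_powerset_insert hbR, sum_powerset_insert hbR,
    ← sum_add_distrib, ← sum_add_distrib, ← sum_add_distrib]
  refine sum_congr rfl fun T hT => ?_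
  have hTR := mem_powerset.mp hT
  have haT : a ∉ T := fun h => haR (hTR h)
  have hbT : b ∉ T := fun h => hbR (hTR h)
  have haD : a ∉ R \ T := by simp [haR]
  have hbD : b ∉ R \ T := by simp [hbR]
  have c₀ : Tᶜ = insert a (insert b (R \ T)) := by
    ext s; simp only [hR, mem_compl, mem_insert, mem_sdiff, mem_erase, mem_univ]; grind
  have c₁ : (insert a T)ᶜ = insert b (R \ T) := by
    ext s; simp only [hR, mem_compl, mem_insert, mem_sdiff, mem_erase, mem_univ]; grind
  have c₂ : (insert b T)ᶜ = insert a (R \ T) := by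
    ext s; simp only [hR, mem_compl, mem_insert, mem_sdiff, mem_erase, mem_univ]; grind
  have c₃ : (insert a (insert b T))ᶜ = R \ T := by
    ext s; simp only [hR, mem_compl, mem_insert, mem_sdiff, mem_erase, mem_univ]; grind
  have haD' : a ∉ insert b (R \ T) := by simp [hab, haR]
  have haT' : a ∉ insert b T := by simp [hab, haT]
  rw [c₀, c₁, c₂, c₃, prod_insert haD', prod_insert hbD, prod_insert haD, prod_insert haT',
    prod_insert haT, prod_insert hbT]
  ring

/-- A real quadratic with nonnegative leading coefficient is convex on every convex set. -/
theorem convexOn_quadratic {s : Set ℝ} (hs : Convex ℝ s) {α : ℝ} (hα : 0 ≤ α) (β γ : ℝ) :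
    ConvexOn ℝ s fun t => α * t ^ 2 + β * t + γ := by
  refine ⟨hs, fun u _ v _ p q hp hq hpq => ?_⟩
  obtain rfl : q = 1 - p := by linarith
  have h : 0 ≤ α * (p * (1 - p)) * (u - v) ^ 2 := by positivity
  simp only [smul_eq_mul]
  linarith [h]

/-- If `f` is submodular then, for distinct `a, b ∈ V` and `x` in the unit cube,
the multilinear extension is convex along the direction `e_a − e_b`, on the set
of `t` for which `x + t(e_a − e_b)` stays in the unit cube. -/
theorem multilinearExt_convex_swap_direction {V : Type*} [Fintype V] [DecidableEq V]
    (f : Finset V → ℝ)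
    (hf : ∀ A B : Finset V, A ⊆ B → ∀ s ∉ B,
      f (B ∪ {s}) - f B ≤ f (A ∪ {s}) - f A)
    (a b : V) (hab : a ≠ b) (x : V → ℝ) (hx : ∀ s, x s ∈ Set.Icc (0 : ℝ) 1) :
    ConvexOn ℝ
      {t : ℝ | ∀ s, x s + t * ((Pi.single a 1 : V → ℝ) s - (Pi.single b 1 : V → ℝ) s)
        ∈ Set.Icc (0 : ℝ) 1}
      (fun t =>
        multilinearExt f
          (fun s => x s + t * ((Pi.single a 1 : V → ℝ) s - (Pi.single b 1 : V → ℝ) s))) := by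
  set d : V → ℝ := fun s => (Pi.single a 1 : V → ℝ) s - (Pi.single b 1 : V → ℝ) s with hd
  have hda : d a = 1 := by simp [hd, hab]
  have hdb : d b = -1 := by simp [hd, hab]
  have hd₀ : ∀ s, s ≠ a → s ≠ b → d s = 0 := fun s h₁ h₂ => by simp [hd, h₁, h₂]
  have hconv : Convex ℝ {t : ℝ | ∀ s, x s + t * d s ∈ Set.Icc (0 : ℝ) 1} := by
    intro u hu v hv p q hp hq hpq s
    convert convex_Icc (0 : ℝ) 1 (hu s) (hv s) hp hq hpq using 1
    simp only [smul_eq_mul]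
    linear_combination (-x s) * hpq
  set R : Finset V := (univ.erase a).erase b with hR
  set w : Finset V → ℝ := fun T => (∏ s ∈ T, x s) * ∏ s ∈ R \ T, (1 - x s) with hw
  have hw₀ : ∀ T, 0 ≤ w T := fun T => mul_nonneg (prod_nonneg fun s _ => (hx s).1)
    (prod_nonneg fun s _ => sub_nonneg.mpr (hx s).2)
  set c : Finset V → ℝ := fun T =>
    f (insert a T) + f (insert b T) - f T - f (insert a (insert b T)) with hc
  have hc₀ : ∀ T ∈ R.powerset, 0 ≤ c T := by
    intro T hT
    have haT : a ∉ insert b T := by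
      simpa [hab] using fun h => by simpa [hR] using mem_powerset.mp hT h
    have h := hf T (insert b T) (subset_insert b T) a haT
    rw [union_comm _ {a}, union_comm _ {a}, ← insert_eq, ← insert_eq] at h
    simp only [hc]
    linarith
  have hF : ∀ t : ℝ, multilinearExt f (fun s => x s + t * d s) =
      (∑ T ∈ R.powerset, w T * c T) * t ^ 2
        + (∑ T ∈ R.powerset, w T * ((1 - x b) * (f (insert a T) - f T)
          + x b * (f (insert a (insert b T)) - f (insert b T))
          - (1 - x a) * (f (insert b T) - f T)
          - x a * (f (insert a (insert b T)) - f (insert a T)))) * t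
        + ∑ T ∈ R.powerset, w T * ((1 - x a) * (1 - x b) * f T + x a * (1 - x b) * f (insert a T)
          + (1 - x a) * x b * f (insert b T) + x a * x b * f (insert a (insert b T))) := by
    intro t
    rw [multilinearExt_eq_sum_powerset_erase_erase f hab, sum_mul, sum_mul, ← sum_add_distrib,
      ← sum_add_distrib]
    refine sum_congr rfl fun T hT => ?_
    have hy : ∀ s ∈ R, x s + t * d s = x s := fun s hs => by
      rw [hd₀ s (by grind) (by grind), mul_zero, add_zero]
    have h₁ : ∏ s ∈ T, (x s + t * d s) = ∏ s ∈ T, x s :=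
      prod_congr rfl fun s hs => hy s (mem_powerset.mp hT hs)
    have h₂ : ∏ s ∈ R \ T, (1 - (x s + t * d s)) = ∏ s ∈ R \ T, (1 - x s) :=
      prod_congr rfl fun s hs => by rw [hy s (mem_sdiff.mp hs).1]
    simp only [← hR, h₁, h₂, hda, hdb, hw, hc]
    ring
  exact (convexOn_quadratic hconv (sum_nonneg fun T hT => mul_nonneg (hw₀ T) (hc₀ T hT)) _ _).congr
    fun t _ => (hF t).symm
end

section
/- If f is submodular, then its multilinear extension is concave along nonnegative directions: for every x ∈ [0,1]^V and every direction d ∈ ℝ^V with d_s ≥ 0 for all s ∈ V, the function t ↦ F(x + t·d) is concave on the interval of t for which x + t·d remains in [0,1]^V. -/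
open Finset

/-- The multilinear extension of the restriction of a set function to the subsets of `T`. -/
noncomputable def multilinearExtOn {V : Type*} [DecidableEq V]
    (T : Finset V) (f : Finset V → ℝ) (x : V → ℝ) : ℝ :=
  ∑ S ∈ T.powerset, f S * ((∏ s ∈ S, x s) * ∏ s ∈ T \ S, (1 - x s))

theorem multilinearExtOn_univ {V : Type*} [Fintype V] [DecidableEq V]
    (f : Finset V → ℝ) (x : V → ℝ) :
    multilinearExtOn Finset.univ f x = multilinearExt f x := by
  simp [multilinearExtOn, multilinearExt, Finset.compl_eq_univ_sdiff]

section

variable {V : Type*} [DecidableEq V]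

theorem multilinearExtOn_empty (f : Finset V → ℝ) (x : V → ℝ) :
    multilinearExtOn ∅ f x = f ∅ := by
  simp [multilinearExtOn]

theorem multilinearExtOn_insert {T : Finset V} {i : V} (hi : i ∉ T)
    (f : Finset V → ℝ) (x : V → ℝ) :
    multilinearExtOn (insert i T) f x =
      (1 - x i) * multilinearExtOn T f x +
        x i * multilinearExtOn T (fun S => f (insert i S)) x := by
  unfold multilinearExtOn
  rw [Finset.sum_powerset_insert hi, Finset.mul_sum, Finset.mul_sum]
  congr 1
  · refine Finset.sum_congr rfl fun S hS => ?_
    have hiS : i ∉ S := fun h => hi (Finset.mem_powerset.1 hS h)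
    rw [Finset.insert_sdiff_of_notMem _ hiS, Finset.prod_insert (by simp [hi])]
    ring
  · refine Finset.sum_congr rfl fun S hS => ?_
    have hiS : i ∉ S := fun h => hi (Finset.mem_powerset.1 hS h)
    rw [Finset.prod_insert hiS, Finset.insert_sdiff_insert, Finset.sdiff_insert_of_notMem hi]
    ring

theorem multilinearExtOn_sub (T : Finset V) (f g : Finset V → ℝ) (x : V → ℝ) :
    multilinearExtOn T (fun S => f S - g S) x =
      multilinearExtOn T f x - multilinearExtOn T g x := by
  simp only [multilinearExtOn, sub_mul, Finset.sum_sub_distrib]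

theorem multilinearExtOn_le_multilinearExtOn {T : Finset V} {f g : Finset V → ℝ}
    (h : ∀ S ⊆ T, f S ≤ g S) {x : V → ℝ} (hx : ∀ s, x s ∈ Set.Icc (0 : ℝ) 1) :
    multilinearExtOn T f x ≤ multilinearExtOn T g x := by
  refine Finset.sum_le_sum fun S hS =>
    mul_le_mul_of_nonneg_right (h S (Finset.mem_powerset.1 hS)) (mul_nonneg ?_ ?_)
  · exact Finset.prod_nonneg fun s _ => (hx s).1
  · exact Finset.prod_nonneg fun s _ => sub_nonneg.2 (hx s).2

/-- The multilinear extension of a decreasing set function is decreasing on the unit cube. -/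
theorem multilinearExtOn_antitone {T : Finset V} {f : Finset V → ℝ}
    (hf : ∀ A B : Finset V, A ⊆ B → B ⊆ T → f B ≤ f A) {x y : V → ℝ}
    (hx : ∀ s, x s ∈ Set.Icc (0 : ℝ) 1) (hy : ∀ s, y s ∈ Set.Icc (0 : ℝ) 1) (hxy : x ≤ y) :
    multilinearExtOn T f y ≤ multilinearExtOn T f x := by
  induction T using Finset.induction_on generalizing f with
  | empty => simp [multilinearExtOn_empty]
  | insert i T hi ih =>
    rw [multilinearExtOn_insert hi, multilinearExtOn_insert hi]
    have h₁ := ih (f := f) fun A B hAB hB => hf A B hAB (hB.trans (Finset.subset_insert i T))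
    have h₂ := ih (f := fun S => f (insert i S)) fun A B hAB hB =>
      hf _ _ (Finset.insert_subset_insert i hAB) (Finset.insert_subset_insert i hB)
    have h₃ : multilinearExtOn T (fun S => f (insert i S)) x ≤ multilinearExtOn T f x :=
      multilinearExtOn_le_multilinearExtOn
        (fun S hS => hf _ _ (Finset.subset_insert i S) (Finset.insert_subset_insert i hS)) hx
    nlinarith [mul_le_mul_of_nonneg_left h₁ (sub_nonneg.2 (hy i).2),
      mul_le_mul_of_nonneg_left h₂ (hy i).1,
      mul_nonneg (sub_nonneg.2 (hxy i)) (sub_nonneg.2 h₃)]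

/-- The multilinear extension of a submodular function satisfies the concavity inequality
between comparable points of the unit cube. -/
theorem multilinearExtOn_concave_of_le (T : Finset V) {f : Finset V → ℝ}
    (hf : ∀ A B : Finset V, A ⊆ B → ∀ s ∉ B,
      f (B ∪ {s}) - f B ≤ f (A ∪ {s}) - f A) {x y : V → ℝ}
    (hx : ∀ s, x s ∈ Set.Icc (0 : ℝ) 1) (hy : ∀ s, y s ∈ Set.Icc (0 : ℝ) 1) (hxy : x ≤ y)
    {a b : ℝ} (ha : 0 ≤ a) (hb : 0 ≤ b) (hab : a + b = 1) :
    a * multilinearExtOn T f x + b * multilinearExtOn T f y ≤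
      multilinearExtOn T f (fun s => a * x s + b * y s) := by
  induction T using Finset.induction_on generalizing f with
  | empty => simp [multilinearExtOn_empty, ← add_mul, hab]
  | insert i T hi ih =>
    simp only [multilinearExtOn_insert hi]
    have h₁ := ih hf
    have h₂ := ih (f := fun S => f (insert i S)) fun A B hAB s hs => by
      by_cases hsi : s = i
      · subst hsi
        simp
      · have := hf _ _ (Finset.insert_subset_insert i hAB) s (by simp [hsi, hs])
        simpa only [Finset.insert_union] using this
    have hD : multilinearExtOn T (fun S => f (insert i S) - f S) y ≤
        multilinearExtOn T (fun S => f (insert i S) - f S) x := by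
      refine multilinearExtOn_antitone (fun A B hAB hB => ?_) hx hy hxy
      simpa only [Finset.union_singleton] using hf A B hAB i fun h => hi (hB h)
    rw [multilinearExtOn_sub, multilinearExtOn_sub] at hD
    have hz₀ : 0 ≤ a * x i + b * y i :=
      add_nonneg (mul_nonneg ha (hx i).1) (mul_nonneg hb (hy i).1)
    have hz₁ : 0 ≤ 1 - (a * x i + b * y i) := by
      nlinarith [mul_le_mul_of_nonneg_left (hx i).2 ha, mul_le_mul_of_nonneg_left (hy i).2 hb]
    have h₃ := mul_le_mul_of_nonneg_left h₁ hz₁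
    have h₄ := mul_le_mul_of_nonneg_left h₂ hz₀
    have h₅ := mul_nonneg (mul_nonneg ha hb) (mul_nonneg (sub_nonneg.2 (hxy i)) (sub_nonneg.2 hD))
    obtain rfl : a = 1 - b := by linarith
    linarith

end

/-- If `f` is submodular, its multilinear extension is concave along every
nonnegative direction `d`, on the set of `t` for which `x + t·d` stays in the
unit cube. -/
theorem multilinearExt_concave_nonneg_direction {V : Type*} [Fintype V] [DecidableEq V]
    (f : Finset V → ℝ)
    (hf : ∀ A B : Finset V, A ⊆ B → ∀ s ∉ B,
      f (B ∪ {s}) - f B ≤ f (A ∪ {s}) - f A)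
    (x : V → ℝ) (hx : ∀ s, x s ∈ Set.Icc (0 : ℝ) 1)
    (d : V → ℝ) (hd : ∀ s, 0 ≤ d s) :
    ConcaveOn ℝ
      {t : ℝ | ∀ s, x s + t * d s ∈ Set.Icc (0 : ℝ) 1}
      (fun t => multilinearExt f (fun s => x s + t * d s)) := by
  have concave_le : ∀ t u : ℝ, (∀ s, x s + t * d s ∈ Set.Icc (0 : ℝ) 1) →
      (∀ s, x s + u * d s ∈ Set.Icc (0 : ℝ) 1) → t ≤ u → ∀ a b : ℝ, 0 ≤ a → 0 ≤ b → a + b = 1 →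
      a * multilinearExt f (fun s => x s + t * d s) +
        b * multilinearExt f (fun s => x s + u * d s) ≤
          multilinearExt f (fun s => x s + (a * t + b * u) * d s) := by
    intro t u ht hu htu a b ha hb hab
    have key := multilinearExtOn_concave_of_le Finset.univ hf ht hu
      (fun s => add_le_add le_rfl (mul_le_mul_of_nonneg_right htu (hd s))) ha hb hab
    simp only [multilinearExtOn_univ] at key
    convert key using 3 with s
    linear_combination (-x s) * hab
  refine ⟨fun t ht u hu a b ha hb hab s => ?_, fun t ht u hu a b ha hb hab => ?_⟩
  · have h := convex_Icc (0 : ℝ) 1 (ht s) (hu s) ha hb hab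
    simp only [smul_eq_mul] at h ⊢
    convert h using 1
    linear_combination (-x s) * hab
  · rcases le_total t u with htu | hut
    · exact concave_le t u ht hu htu a b ha hb hab
    · have h := concave_le u t hu ht hut b a hb ha (by linarith)
      simp only [smul_eq_mul]
      rwa [add_comm, add_comm (a * t)]
end

section
/- Let f: 2^V → ℝ be normalized (f(∅) = 0), monotone increasing and submodular, and let r ≥ 1. Let G_0 = ∅ and, for each 0 ≤ i < r, let G_{i+1} = G_i ∪ {s_i} where s_i ∈ V maximizes the marginal gain, i.e., f(G_i ∪ {s_i}) ≥ f(G_i ∪ {s}) for all s ∈ V. Then the greedy solution satisfies f(G_r) ≥ (1 − 1/e) · f(S*) for every S* ⊆ V with |S*| ≤ r; in particular f(G_r) ≥ (1 − 1/e) · max_{|S| ≤ r} f(S). -/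
open Finset

/-- If every single-element marginal gain over `A` is at most `δ ≥ 0`, then adding a set `T`
to `A` gains at most `|T| · δ`. -/
theorem submodular_union_le {V : Type*} [DecidableEq V] {f : Finset V → ℝ}
    (hsub : ∀ A B : Finset V, A ⊆ B → ∀ s ∉ B,
      f (B ∪ {s}) - f B ≤ f (A ∪ {s}) - f A)
    {A : Finset V} {δ : ℝ} (hδ : 0 ≤ δ) (hgain : ∀ t, f (insert t A) ≤ f A + δ)
    (T : Finset V) : f (A ∪ T) ≤ f A + T.card * δ := by
  induction T using Finset.induction_on with
  | empty => simp
  | insert t T ht ih =>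
    rw [Finset.card_insert_of_notMem ht, Finset.union_insert]
    push_cast
    by_cases h : t ∈ A ∪ T
    · rw [Finset.insert_eq_of_mem h]
      linarith
    · have h₁ := hsub A (A ∪ T) Finset.subset_union_left t h
      have h₂ := hgain t
      rw [Finset.union_singleton, Finset.union_singleton] at h₁
      linarith

/-- Nemhauser–Wolsey–Fisher greedy performance guarantee: if `f` is normalized,
monotone increasing and submodular, and `G` is produced by `r` greedy steps
(each step adds an element of `V` maximizing the marginal gain), then
`f(G_r) ≥ (1 − 1/e) · f(S*)` for every `S*` of cardinality at most `r`. -/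
theorem greedy_performance_guarantee {V : Type*} [Fintype V] [DecidableEq V]
    (f : Finset V → ℝ)
    (hnorm : f ∅ = 0)
    (hmono : ∀ A B : Finset V, A ⊆ B → f A ≤ f B)
    (hsub : ∀ A B : Finset V, A ⊆ B → ∀ s ∉ B,
      f (B ∪ {s}) - f B ≤ f (A ∪ {s}) - f A)
    (r : ℕ) (hr : 1 ≤ r)
    (G : ℕ → Finset V) (hG0 : G 0 = ∅)
    (hGstep : ∀ i < r, ∃ s : V,
      G (i + 1) = insert s (G i) ∧ ∀ t : V, f (insert t (G i)) ≤ f (insert s (G i)))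
    (S : Finset V) (hS : S.card ≤ r) :
    (1 - 1 / Real.exp 1) * f S ≤ f (G r) := by
  have hr₀ : (0 : ℝ) < r := by exact_mod_cast hr
  have hr₁ : (1 : ℝ) ≤ r := by exact_mod_cast hr
  have hcoef : (0 : ℝ) ≤ 1 - 1 / r := by
    rw [sub_nonneg, div_le_one hr₀]
    exact hr₁
  have hfS : 0 ≤ f S := hnorm ▸ hmono ∅ S (Finset.empty_subset S)
  have hdecay : ∀ i ≤ r, f S - f (G i) ≤ (1 - 1 / (r : ℝ)) ^ i * f S := by
    intro i
    induction i with
    | zero => simp [hG0, hnorm]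
    | succ i ih =>
      intro hi
      obtain ⟨s, hs, hmax⟩ := hGstep i hi
      have hδ : 0 ≤ f (G (i + 1)) - f (G i) := by
        rw [hs, sub_nonneg]
        exact hmono _ _ (Finset.subset_insert _ _)
      have hunion := submodular_union_le hsub hδ
        (fun t => by rw [add_sub_cancel, hs]; exact hmax t) S
      have hle := hmono S (G i ∪ S) Finset.subset_union_right
      have hcard : (S.card : ℝ) * (f (G (i + 1)) - f (G i)) ≤
          r * (f (G (i + 1)) - f (G i)) :=
        mul_le_mul_of_nonneg_right (by exact_mod_cast hS) hδ
      have hgap : (f S - f (G i)) / r ≤ f (G (i + 1)) - f (G i) := by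
        rw [div_le_iff₀' hr₀]
        linarith
      calc f S - f (G (i + 1)) ≤ f S - f (G i) - (f S - f (G i)) / r := by linarith
        _ = (1 - 1 / (r : ℝ)) * (f S - f (G i)) := by ring
        _ ≤ (1 - 1 / (r : ℝ)) * ((1 - 1 / (r : ℝ)) ^ i * f S) :=
          mul_le_mul_of_nonneg_left (ih (by omega)) hcoef
        _ = (1 - 1 / (r : ℝ)) ^ (i + 1) * f S := by ring
  have hexp : (1 - 1 / (r : ℝ)) ^ r ≤ 1 / Real.exp 1 := by
    rw [one_div (Real.exp 1), ← Real.exp_neg]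
    exact Real.one_sub_div_pow_le_exp_neg hr₁
  have hfinal := mul_le_mul_of_nonneg_right hexp hfS
  linarith [hdecay r le_rfl]
end
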